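/- (Sufficient concept coverage.) Let C be a finite type of concepts, let q : C → ℝ be a probability mass function on C (∀ c, 0 ≤ q c, and ∑ c, q c = 1), let p : C → ℝ satisfy 0 ≤ p c ≤ 1 for all c, let r : ℝ with 0 < r ≤ 1, and let R ⊆ C. Suppose there is a function k : C → ℝ such that for every c ∈ R, k c > 1 and p c = k c · r, and let kmin : ℝ satisfy kmin > 1 and kmin ≤ k c for all c ∈ R. Define P_GS = ∑ c, q c · p c and P(R) = ∑_{c ∈ R} q c. If P(R) > 1 / kmin, then P_GS > r. -/

import Mathlib

theorem stmt_3 {C : Type*} [Fintype C] [DecidableEq C] (q p : C → ℝ) (r : ℝ)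
    (R : Finset C) (k : C → ℝ) (kmin : ℝ)
    (hq : ∀ c, 0 ≤ q c) (hqsum : ∑ c, q c = 1)
    (hp : ∀ c, 0 ≤ p c ∧ p c ≤ 1) (hr0 : 0 < r) (hr1 : r ≤ 1)
    (hkR : ∀ c ∈ R, 1 < k c ∧ p c = k c * r)
    (hkmin : 1 < kmin) (hkmin_le : ∀ c ∈ R, kmin ≤ k c)
    (hcov : (∑ c ∈ R, q c) > 1 / kmin) :
    ∑ c, q c * p c > r := by
  have hpos : 0 < kmin := one_pos.trans hkmin
  have hcov' : 1 < (∑ c ∈ R, q c) * kmin := (div_lt_iff₀ hpos).mp hcov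
  calc r < (∑ c ∈ R, q c) * kmin * r := lt_mul_of_one_lt_left hr0 hcov'
    _ = ∑ c ∈ R, q c * (kmin * r) := by rw [mul_assoc, Finset.sum_mul]
    _ ≤ ∑ c ∈ R, q c * p c := by
      refine Finset.sum_le_sum fun c hc => mul_le_mul_of_nonneg_left ?_ (hq c)
      rw [(hkR c hc).2]
      exact mul_le_mul_of_nonneg_right (hkmin_le c hc) hr0.le
    _ ≤ ∑ c, q c * p c :=
      Finset.sum_le_sum_of_subset_of_nonneg (Finset.subset_univ R)
        fun c _ _ => mul_nonneg (hq c) (hp c).1
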